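/- arXiv:2508.01876 — 3 statements merged into one kernel-verified Lean document; each statement's English description precedes it below -/
import Mathlib

section
/- Consider the Interaction 1 guiding system F : ℝ² → ℝ², F(Σ,Ω) = ((3/2)·Σ·(−γ(Σ²+Ω²−1)+2Σ²+Ω²−2), −(3/2)·Ω·(γ(Σ²+Ω²−1)−2Σ²−Ω²+1)), with parameter γ ∈ [0,2]. Then (0,0) is an equilibrium point (F(0,0) = 0), the Jacobian matrix of F at (0,0) is the diagonal matrix with diagonal entries 3(γ−2)/2 and 3(γ−1)/2, and both entries are negative if and only if 0 ≤ γ < 1 (so (0,0) is a hyperbolic sink for 0 ≤ γ < 1), while for 1 < γ < 2 the two entries have opposite signs (so (0,0) is a saddle). -/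
/-- Interaction 1 guiding system: `(0,0)` is an equilibrium, its Jacobian is
`diag(3(γ−2)/2, 3(γ−1)/2)`, both eigenvalues are negative iff `0 ≤ γ < 1`
(hyperbolic sink), and for `1 < γ < 2` they have opposite signs (saddle). -/
theorem interaction1_origin_equilibrium_stability
    (γ : ℝ) (hγ0 : 0 ≤ γ) (hγ2 : γ ≤ 2)
    (F : ℝ × ℝ → ℝ × ℝ)
    (hF : ∀ p : ℝ × ℝ, F p =
      ((3 / 2) * p.1 * (-γ * (p.1 ^ 2 + p.2 ^ 2 - 1) + 2 * p.1 ^ 2 + p.2 ^ 2 - 2),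
       -(3 / 2) * p.2 * (γ * (p.1 ^ 2 + p.2 ^ 2 - 1) - 2 * p.1 ^ 2 - p.2 ^ 2 + 1))) :
    F (0, 0) = (0, 0) ∧
    HasFDerivAt F
      (((3 * (γ - 2) / 2) • ContinuousLinearMap.id ℝ ℝ).prodMap
        ((3 * (γ - 1) / 2) • ContinuousLinearMap.id ℝ ℝ)) (0, 0) ∧
    ((3 * (γ - 2) / 2 < 0 ∧ 3 * (γ - 1) / 2 < 0) ↔ (0 ≤ γ ∧ γ < 1)) ∧
    (1 < γ ∧ γ < 2 → 3 * (γ - 2) / 2 < 0 ∧ 0 < 3 * (γ - 1) / 2) := by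
  obtain rfl : F = _ := funext hF
  refine ⟨by simp, ?_, ⟨fun h => ⟨hγ0, by linarith [h.2]⟩, fun h => ⟨by linarith, by linarith⟩⟩,
    fun h => ⟨by linarith, by linarith⟩⟩
  have hfst : HasFDerivAt (fun p : ℝ × ℝ => p.1) (ContinuousLinearMap.fst ℝ ℝ ℝ) (0, 0) :=
    hasFDerivAt_fst
  have hsnd : HasFDerivAt (fun p : ℝ × ℝ => p.2) (ContinuousLinearMap.snd ℝ ℝ ℝ) (0, 0) :=
    hasFDerivAt_snd
  have hA : DifferentiableAt ℝ (fun p : ℝ × ℝ =>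
      -γ * (p.1 ^ 2 + p.2 ^ 2 - 1) + 2 * p.1 ^ 2 + p.2 ^ 2 - 2) (0, 0) := by fun_prop
  have hB : DifferentiableAt ℝ (fun p : ℝ × ℝ =>
      γ * (p.1 ^ 2 + p.2 ^ 2 - 1) - 2 * p.1 ^ 2 - p.2 ^ 2 + 1) (0, 0) := by fun_prop
  refine (((hfst.const_mul (3 / 2)).mul hA.hasFDerivAt).prodMk
    ((hsnd.const_mul (-(3 / 2))).mul hB.hasFDerivAt)).congr_fderiv ?_
  ext <;> simp <;> ring
end

section
/- Consider the Interaction 1 guiding system F : ℝ² → ℝ², F(Σ,Ω) = ((3/2)·Σ·(−γ(Σ²+Ω²−1)+2Σ²+Ω²−2), −(3/2)·Ω·(γ(Σ²+Ω²−1)−2Σ²−Ω²+1)), with parameter γ ∈ [0,2]. Then (1,0) and (−1,0) are equilibrium points, at each of them the Jacobian matrix of F is the diagonal matrix with diagonal entries 3(2−γ) and 3/2, and both entries are positive if and only if 0 ≤ γ < 2 (so these points are hyperbolic sources for 0 ≤ γ < 2). -/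
/-- The derivative of the Interaction 1 vector field at a point `(s, 0)` with `s ^ 2 = 1`. -/
lemma hasFDerivAt_interaction1_of_sq_eq_one (γ : ℝ) {s : ℝ} (hs : s ^ 2 = 1) :
    HasFDerivAt (fun p : ℝ × ℝ =>
      ((3 / 2) * p.1 * (-γ * (p.1 ^ 2 + p.2 ^ 2 - 1) + 2 * p.1 ^ 2 + p.2 ^ 2 - 2),
       -(3 / 2) * p.2 * (γ * (p.1 ^ 2 + p.2 ^ 2 - 1) - 2 * p.1 ^ 2 - p.2 ^ 2 + 1)))
      (((3 * (2 - γ)) • ContinuousLinearMap.id ℝ ℝ).prodMap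
        ((3 / 2 : ℝ) • ContinuousLinearMap.id ℝ ℝ)) (s, 0) := by
  have hx : HasFDerivAt (fun p : ℝ × ℝ => p.1) (ContinuousLinearMap.fst ℝ ℝ ℝ) (s, 0) :=
    hasFDerivAt_fst
  have hy : HasFDerivAt (fun p : ℝ × ℝ => p.2) (ContinuousLinearMap.snd ℝ ℝ ℝ) (s, 0) :=
    hasFDerivAt_snd
  have hx2 := hx.pow 2
  have hy2 := hy.pow 2
  have hr := (hx2.add hy2).sub_const 1
  have hfst := (hx.const_mul (3 / 2)).mul
    ((((hr.const_mul (-γ)).add (hx2.const_mul 2)).add hy2).sub_const 2)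
  have hsnd := (hy.const_mul (-(3 / 2))).mul
    ((((hr.const_mul γ).sub (hx2.const_mul 2)).sub hy2).add_const 1)
  refine (hfst.prodMk hsnd).congr_fderiv ?_
  ext <;> simp
  · linear_combination (9 - 9 / 2 * γ) * hs
  · linear_combination (3 - 3 / 2 * γ) * hs


/-- Interaction 1 guiding system: `(±1,0)` are equilibria, at each the Jacobian is
`diag(3(2−γ), 3/2)`, and both eigenvalues are positive iff `0 ≤ γ < 2`
(hyperbolic sources). -/
theorem interaction1_anisotropic_points_stability
    (γ : ℝ) (hγ0 : 0 ≤ γ) (hγ2 : γ ≤ 2)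
    (F : ℝ × ℝ → ℝ × ℝ)
    (hF : ∀ p : ℝ × ℝ, F p =
      ((3 / 2) * p.1 * (-γ * (p.1 ^ 2 + p.2 ^ 2 - 1) + 2 * p.1 ^ 2 + p.2 ^ 2 - 2),
       -(3 / 2) * p.2 * (γ * (p.1 ^ 2 + p.2 ^ 2 - 1) - 2 * p.1 ^ 2 - p.2 ^ 2 + 1))) :
    F (1, 0) = (0, 0) ∧ F (-1, 0) = (0, 0) ∧
    HasFDerivAt F
      (((3 * (2 - γ)) • ContinuousLinearMap.id ℝ ℝ).prodMap
        ((3 / 2 : ℝ) • ContinuousLinearMap.id ℝ ℝ)) (1, 0) ∧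
    HasFDerivAt F
      (((3 * (2 - γ)) • ContinuousLinearMap.id ℝ ℝ).prodMap
        ((3 / 2 : ℝ) • ContinuousLinearMap.id ℝ ℝ)) (-1, 0) ∧
    ((0 < 3 * (2 - γ) ∧ 0 < (3 / 2 : ℝ)) ↔ (0 ≤ γ ∧ γ < 2)) := by
  obtain rfl : F = _ := funext hF
  refine ⟨by norm_num, by norm_num, hasFDerivAt_interaction1_of_sq_eq_one γ (by norm_num),
    hasFDerivAt_interaction1_of_sq_eq_one γ (by norm_num), fun h => ⟨hγ0, by linarith [h.1]⟩,
    fun h => ⟨by linarith [h.2], by norm_num⟩⟩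
end

section
/- Consider the Interaction 3 guiding system F : {(Σ,Ω) : Ω ≠ 0} → ℝ², F(Σ,Ω) = ((3/2)·Σ·(−γ(Σ²+Ω²−1)+2Σ²+Ω²−2), −Γ̄·(Σ²+Ω²−1)/Ω − 3Ω·(γ(Σ²+Ω²−1)−2Σ²−Ω²+1)), with parameters γ ∈ [0,1) and Γ̄ satisfying 0 < Γ̄ < 3(1−γ). Set Ω₅ := √(Γ̄/(3(1−γ))). Then (0,Ω₅) is an equilibrium point of F, the Jacobian matrix of F at (0,Ω₅) is the diagonal matrix with diagonal entries (Γ̄+3γ−6)/2 and 2(Γ̄+3γ−3), and under the stated hypotheses both entries are negative, so (0,Ω₅) is a hyperbolic sink. -/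
/-- Interaction 3 guiding system: for `0 ≤ γ < 1` and `0 < Γ̄ < 3(1−γ)`, the point
`P₅ = (0, √(Γ̄/(3(1−γ))))` is an equilibrium, its Jacobian is
`diag((Γ̄+3γ−6)/2, 2(Γ̄+3γ−3))`, and both eigenvalues are negative, so it is a
hyperbolic sink. -/
theorem interaction3_P5_sink
    (γ Γ : ℝ) (hγ0 : 0 ≤ γ) (hγ1 : γ < 1)
    (hΓ0 : 0 < Γ) (hΓ : Γ < 3 * (1 - γ))
    (Ω₅ : ℝ) (hΩ₅ : Ω₅ = Real.sqrt (Γ / (3 * (1 - γ))))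
    (F : ℝ × ℝ → ℝ × ℝ)
    (hF : ∀ p : ℝ × ℝ, F p =
      ((3 / 2) * p.1 * (-γ * (p.1 ^ 2 + p.2 ^ 2 - 1) + 2 * p.1 ^ 2 + p.2 ^ 2 - 2),
       -Γ * (p.1 ^ 2 + p.2 ^ 2 - 1) / p.2
         - 3 * p.2 * (γ * (p.1 ^ 2 + p.2 ^ 2 - 1) - 2 * p.1 ^ 2 - p.2 ^ 2 + 1))) :
    F (0, Ω₅) = (0, 0) ∧
    HasFDerivAt F
      ((((Γ + 3 * γ - 6) / 2) • ContinuousLinearMap.id ℝ ℝ).prodMap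
        ((2 * (Γ + 3 * γ - 3)) • ContinuousLinearMap.id ℝ ℝ)) (0, Ω₅) ∧
    (Γ + 3 * γ - 6) / 2 < 0 ∧ 2 * (Γ + 3 * γ - 3) < 0 := by
  have h1γ : 0 < 1 - γ := by linarith
  have hΩ : 0 < Ω₅ := by rw [hΩ₅]; positivity
  have hsq : 3 * (1 - γ) * Ω₅ ^ 2 = Γ := by
    rw [hΩ₅, Real.sq_sqrt (by positivity)]
    field_simp
  have hF' : F = fun p : ℝ × ℝ =>
      ((3 / 2) * p.1 * (-γ * (p.1 ^ 2 + p.2 ^ 2 - 1) + 2 * p.1 ^ 2 + p.2 ^ 2 - 2),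
       -Γ * (p.1 ^ 2 + p.2 ^ 2 - 1) * p.2⁻¹
         - 3 * p.2 * (γ * (p.1 ^ 2 + p.2 ^ 2 - 1) - 2 * p.1 ^ 2 - p.2 ^ 2 + 1)) := by
    funext p
    rw [hF p, div_eq_mul_inv (-Γ * _)]
  refine ⟨?_, ?_, by linarith, by linarith⟩
  · rw [hF]
    ext
    · simp
    · simp only
      rw [← hsq]
      field_simp
      ring
  · rw [hF']
    have hx : HasFDerivAt (fun p : ℝ × ℝ => p.1) (ContinuousLinearMap.fst ℝ ℝ ℝ) (0, Ω₅) :=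
      hasFDerivAt_fst
    have hy : HasFDerivAt (fun p : ℝ × ℝ => p.2) (ContinuousLinearMap.snd ℝ ℝ ℝ) (0, Ω₅) :=
      hasFDerivAt_snd
    have hi := (hasDerivAt_inv hΩ.ne').comp_hasFDerivAt ((0 : ℝ), Ω₅) hy
    have hx2 := HasFDerivAt.pow hx 2
    have hy2 := HasFDerivAt.pow hy 2
    have hr := (hx2.add hy2).sub_const 1
    have hA := (hx.const_mul (3 / 2)).mul
      ((((hr.const_mul (-γ)).add (hx2.const_mul 2)).add hy2).sub_const 2)
    have hB := ((hr.const_mul (-Γ)).mul hi).sub ((hy.const_mul 3).mul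
      ((((hr.const_mul γ).sub (hx2.const_mul 2)).sub hy2).add_const 1))
    refine (hA.prodMk hB).congr_fderiv ?_
    ext
    · simp
      linear_combination (1 / 2) * hsq
    · simp
    · simp
    · simp
      rw [← hsq]
      field_simp
      ring
end
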